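/- arXiv:2310.12712 — 9 statements merged into one kernel-verified Lean document; each statement's English description precedes it below -/
import Mathlib

section
/- Let f : ℝ^d → ℝ be twice continuously differentiable on a ball B(x₀, r), and suppose the second derivative ∇²f is Lipschitz on B(x₀, r) with constant L. Let x₀, x₁, …, x_d ∈ B(x₀, r) with invertible difference matrix S (columns s_i = x_i − x₀, each with ‖s_i‖₂ < r), and let δf ∈ ℝ^d have entries δf_i = f(x_i) − f(x₀). Let q(S) ∈ ℝ^d have entries q(S)_i = s_iᵀ ∇²f(x₀) s_i. Then ‖S^{-T} δf − ∇f(x₀) − (1/2) S^{-T} q(S)‖₂ ≤ (L/6) · ‖S^{-T}‖₂ · ( Σ_{i=1}^d ‖s_i‖₂⁶ )^{1/2}, where ‖S^{-T}‖₂ is the ℓ²-operator norm of S^{-T} = (Sᵀ)^{-1}. In particular the squared approximation error of the simplex gradient equals (1/4)‖S^{-T} q(S)‖₂² up to a term of order ‖S‖₂³ as ‖S‖₂ → 0. -/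
open Matrix

/-- The Euclidean (ℓ²) norm of a vector in `Fin d → ℝ`. -/
noncomputable def euclNorm {d : ℕ} (v : Fin d → ℝ) : ℝ := Real.sqrt (∑ k, v k ^ 2)

/-- The ℓ²-operator norm of a square real matrix. -/
noncomputable def opNorm {d : ℕ} (M : Matrix (Fin d) (Fin d) ℝ) : ℝ :=
  ‖Matrix.toEuclideanCLM (𝕜 := ℝ) M‖

lemma abs_taylor_two_sub_le (g g' g'' : ℝ → ℝ) (C : ℝ)
    (hg : ∀ t ∈ Set.Icc (0 : ℝ) 1, HasDerivAt g (g' t) t)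
    (hg' : ∀ t ∈ Set.Icc (0 : ℝ) 1, HasDerivAt g' (g'' t) t)
    (hb : ∀ t ∈ Set.Icc (0 : ℝ) 1, |g'' t - g'' 0| ≤ C * t) :
    |g 1 - g 0 - g' 0 - 1 / 2 * g'' 0| ≤ C / 6 := by
  have hd' : ∀ t ∈ Set.Icc (0 : ℝ) 1,
      HasDerivAt (fun t => g' t - g' 0 - t * g'' 0) (g'' t - g'' 0) t := fun t ht => by
    refine (((hg' t ht).sub_const (g' 0)).sub
      ((hasDerivAt_id t).mul_const (g'' 0))).congr_deriv ?_
    rw [one_mul]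
  have hB' : ∀ t : ℝ, HasDerivAt (fun t => C / 2 * t ^ 2) (C * t) t := fun t => by
    refine ((hasDerivAt_pow 2 t).const_mul (C / 2)).congr_deriv ?_
    norm_num; ring
  have hfirst : ∀ t ∈ Set.Icc (0 : ℝ) 1, ‖g' t - g' 0 - t * g'' 0‖ ≤ C / 2 * t ^ 2 :=
    image_norm_le_of_norm_deriv_right_le_deriv_boundary
      (fun t ht => (hd' t ht).continuousAt.continuousWithinAt)
      (fun t ht => (hd' t (Set.Ico_subset_Icc_self ht)).hasDerivWithinAt)
      (by simp) hB' (fun t ht => hb t (Set.Ico_subset_Icc_self ht))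
  have hd : ∀ t ∈ Set.Icc (0 : ℝ) 1,
      HasDerivAt (fun t => g t - g 0 - t * g' 0 - t ^ 2 * (1 / 2 * g'' 0))
        (g' t - g' 0 - t * g'' 0) t := fun t ht => by
    refine ((((hg t ht).sub_const (g 0)).sub ((hasDerivAt_id t).mul_const (g' 0))).sub
      ((hasDerivAt_pow 2 t).mul_const (1 / 2 * g'' 0))).congr_deriv ?_
    norm_num; ring
  have hB : ∀ t : ℝ, HasDerivAt (fun t => C / 6 * t ^ 3) (C / 2 * t ^ 2) t := fun t => by
    refine ((hasDerivAt_pow 3 t).const_mul (C / 6)).congr_deriv ?_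
    norm_num; ring
  have h := image_norm_le_of_norm_deriv_right_le_deriv_boundary
      (fun t ht => (hd t ht).continuousAt.continuousWithinAt)
      (fun t ht => (hd t (Set.Ico_subset_Icc_self ht)).hasDerivWithinAt)
      (by simp) hB (fun t ht => hfirst t (Set.Ico_subset_Icc_self ht))
      (Set.right_mem_Icc.2 zero_le_one)
  simpa using h

lemma euclNorm_eq_norm {d : ℕ} (v : Fin d → ℝ) : euclNorm v = ‖WithLp.toLp 2 v‖ := by
  simp [euclNorm, EuclideanSpace.norm_eq]

lemma euclNorm_nonneg {d : ℕ} (v : Fin d → ℝ) : 0 ≤ euclNorm v := Real.sqrt_nonneg _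

lemma euclNorm_sq {d : ℕ} (v : Fin d → ℝ) : euclNorm v ^ 2 = ∑ k, v k ^ 2 :=
  Real.sq_sqrt (Finset.sum_nonneg fun _ _ => sq_nonneg _)

lemma euclNorm_smul {d : ℕ} (c : ℝ) (v : Fin d → ℝ) : euclNorm (c • v) = |c| * euclNorm v := by
  simp [euclNorm_eq_norm, norm_smul]

lemma euclNorm_mulVec_le {d : ℕ} (M : Matrix (Fin d) (Fin d) ℝ) (v : Fin d → ℝ) :
    euclNorm (M.mulVec v) ≤ opNorm M * euclNorm v := by
  simpa [euclNorm_eq_norm, opNorm] using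
    (Matrix.toEuclideanCLM (𝕜 := ℝ) M).le_opNorm (WithLp.toLp 2 v)

lemma abs_dotProduct_le {d : ℕ} (v w : Fin d → ℝ) : |v ⬝ᵥ w| ≤ euclNorm v * euclNorm w := by
  have h := abs_real_inner_le_norm (WithLp.toLp 2 w) (WithLp.toLp 2 v)
  rw [mul_comm] at h
  simpa [euclNorm_eq_norm, EuclideanSpace.inner_eq_star_dotProduct] using h

lemma abs_dotProduct_mulVec_le {d : ℕ} (M : Matrix (Fin d) (Fin d) ℝ) (v : Fin d → ℝ) :
    |v ⬝ᵥ M.mulVec v| ≤ opNorm M * euclNorm v ^ 2 :=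
  calc |v ⬝ᵥ M.mulVec v| ≤ euclNorm v * euclNorm (M.mulVec v) := abs_dotProduct_le _ _
    _ ≤ euclNorm v * (opNorm M * euclNorm v) :=
      mul_le_mul_of_nonneg_left (euclNorm_mulVec_le M v) (euclNorm_nonneg v)
    _ = _ := by ring

/-- Second-order Taylor estimate along a segment for a function whose Hessian is Lipschitz. -/
lemma abs_taylor_sub_le_of_lipschitz_hessian
    {d : ℕ} {r L : ℝ} (x₀ : Fin d → ℝ) (f : (Fin d → ℝ) → ℝ)
    (gradf : (Fin d → ℝ) → (Fin d → ℝ))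
    (hess : (Fin d → ℝ) → Matrix (Fin d) (Fin d) ℝ)
    (φ : (Fin d → ℝ) → ((Fin d → ℝ) →L[ℝ] ℝ))
    (ψ : (Fin d → ℝ) → ((Fin d → ℝ) →L[ℝ] (Fin d → ℝ)))
    (hφ : ∀ z v, φ z v = ∑ k, gradf z k * v k)
    (hψ : ∀ z v, ψ z v = (hess z).mulVec v)
    (hgrad : ∀ z, euclNorm (z - x₀) < r → HasFDerivAt f (φ z) z)
    (hhess : ∀ z, euclNorm (z - x₀) < r → HasFDerivAt gradf (ψ z) z)
    (hLip : ∀ z, euclNorm (z - x₀) < r → opNorm (hess z - hess x₀) ≤ L * euclNorm (z - x₀))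
    (s : Fin d → ℝ) (hs : euclNorm s < r) :
    |f (x₀ + s) - f x₀ - s ⬝ᵥ gradf x₀ - 1 / 2 * (s ⬝ᵥ (hess x₀).mulVec s)|
      ≤ L * euclNorm s ^ 3 / 6 := by
  have hnorm : ∀ t ∈ Set.Icc (0 : ℝ) 1, euclNorm (x₀ + t • s - x₀) = t * euclNorm s :=
    fun t ht => by rw [add_sub_cancel_left, euclNorm_smul, abs_of_nonneg ht.1]
  have hmem : ∀ t ∈ Set.Icc (0 : ℝ) 1, euclNorm (x₀ + t • s - x₀) < r := fun t ht => by
    rw [hnorm t ht]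
    exact (mul_le_of_le_one_left (euclNorm_nonneg s) ht.2).trans_lt hs
  have hline : ∀ t : ℝ, HasDerivAt (fun t : ℝ => x₀ + t • s) s t := fun t => by
    simpa using ((hasDerivAt_id t).smul_const s).const_add x₀
  have h := abs_taylor_two_sub_le (fun t => f (x₀ + t • s))
    (fun t => s ⬝ᵥ gradf (x₀ + t • s)) (fun t => s ⬝ᵥ (hess (x₀ + t • s)).mulVec s)
    (L * euclNorm s ^ 3)
    (fun t ht => by
      refine ((hgrad _ (hmem t ht)).comp_hasDerivAt t (hline t)).congr_deriv ?_
      rw [hφ, dotProduct_comm]; rfl)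
    (fun t ht => by
      have h1 := (hhess _ (hmem t ht)).comp_hasDerivAt t (hline t)
      rw [hψ] at h1
      exact HasDerivAt.fun_sum fun k _ => ((hasDerivAt_pi.1 h1) k).const_mul (s k))
    (fun t ht => by
      have h1 := hLip _ (hmem t ht)
      rw [hnorm t ht] at h1
      have h2 := abs_dotProduct_mulVec_le (hess (x₀ + t • s) - hess x₀) s
      simp only [zero_smul, add_zero]
      rw [← dotProduct_sub, ← Matrix.sub_mulVec]
      refine h2.trans ((mul_le_mul_of_nonneg_right h1 (sq_nonneg _)).trans_eq (by ring)))
  simpa only [one_smul, zero_smul, add_zero] using h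

lemma euclNorm_le_sqrt_sum_pow {d : ℕ} {c : ℝ} (hc : 0 ≤ c) (v : Fin d → ℝ)
    (S : Matrix (Fin d) (Fin d) ℝ)
    (hv : ∀ j, |v j| ≤ c * euclNorm (fun k => S k j) ^ 3) :
    euclNorm v ≤ c * Real.sqrt (∑ j, (∑ k, S k j ^ 2) ^ 3) := by
  rw [euclNorm, Real.sqrt_le_left (by positivity), mul_pow, Real.sq_sqrt (by positivity),
    Finset.mul_sum]
  refine Finset.sum_le_sum fun j _ => ?_
  rw [← euclNorm_sq (fun k => S k j), ← sq_abs]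
  exact (pow_le_pow_left₀ (abs_nonneg _) (hv j) 2).trans_eq (by ring)

/-- Third-order Taylor-type bound on the deviation of the simplex gradient
from `∇f(x₀) + (1/2) S⁻ᵀ q(S)` with `q(S)ᵢ = sᵢᵀ ∇²f(x₀) sᵢ`. -/
theorem simplex_gradient_taylor_bound
    (d : ℕ) (r L : ℝ) (hr : 0 < r) (hL : 0 ≤ L) (x₀ : Fin d → ℝ)
    (f : (Fin d → ℝ) → ℝ)
    (gradf : (Fin d → ℝ) → (Fin d → ℝ))
    (hess : (Fin d → ℝ) → Matrix (Fin d) (Fin d) ℝ)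
    (φ : (Fin d → ℝ) → ((Fin d → ℝ) →L[ℝ] ℝ))
    (ψ : (Fin d → ℝ) → ((Fin d → ℝ) →L[ℝ] (Fin d → ℝ)))
    (hC2 : ContDiffOn ℝ 2 f {z | euclNorm (z - x₀) < r})
    (hφ : ∀ z v, φ z v = ∑ k, gradf z k * v k)
    (hψ : ∀ z v, ψ z v = (hess z).mulVec v)
    (hgrad : ∀ z, euclNorm (z - x₀) < r → HasFDerivAt f (φ z) z)
    (hhess : ∀ z, euclNorm (z - x₀) < r → HasFDerivAt gradf (ψ z) z)
    (hLip : ∀ z w, euclNorm (z - x₀) < r → euclNorm (w - x₀) < r →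
      opNorm (hess z - hess w) ≤ L * euclNorm (z - w))
    (S : Matrix (Fin d) (Fin d) ℝ) (hinv : IsUnit S.det)
    (hcols : ∀ j : Fin d, euclNorm (fun k => S k j) < r) :
    euclNorm (fun k =>
        (Sᵀ)⁻¹.mulVec (fun j : Fin d => f (x₀ + fun a => S a j) - f x₀) k
          - gradf x₀ k
          - (1 / 2) * (Sᵀ)⁻¹.mulVec
              (fun j : Fin d => (fun a => S a j) ⬝ᵥ (hess x₀).mulVec (fun a => S a j)) k)
      ≤ L / 6 * opNorm (Sᵀ)⁻¹ * Real.sqrt (∑ j, (∑ k, S k j ^ 2) ^ 3) := by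
  set R : Fin d → ℝ := fun j => f (x₀ + fun a => S a j) - f x₀ - (fun a => S a j) ⬝ᵥ gradf x₀
    - 1 / 2 * ((fun a => S a j) ⬝ᵥ (hess x₀).mulVec (fun a => S a j)) with hR
  have hx₀ : euclNorm (x₀ - x₀) < r := by simpa [euclNorm] using hr
  have hRbound : ∀ j, |R j| ≤ L / 6 * euclNorm (fun k => S k j) ^ 3 := fun j =>
    (abs_taylor_sub_le_of_lipschitz_hessian x₀ f gradf hess φ ψ hφ hψ hgrad hhess
      (fun z hz => hLip z x₀ hz hx₀) _ (hcols j)).trans_eq (by ring)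
  have hcancel : (Sᵀ)⁻¹.mulVec (Sᵀ.mulVec (gradf x₀)) = gradf x₀ := by
    rw [Matrix.mulVec_mulVec, Matrix.nonsing_inv_mul _ (by rwa [Matrix.det_transpose]),
      Matrix.one_mulVec]
  have hRsplit : R = (fun j : Fin d => f (x₀ + fun a => S a j) - f x₀) - Sᵀ.mulVec (gradf x₀)
      - (1 / 2 : ℝ) • fun j : Fin d =>
        (fun a => S a j) ⬝ᵥ (hess x₀).mulVec (fun a => S a j) := rfl
  have hres : (Sᵀ)⁻¹.mulVec R = fun k =>
      (Sᵀ)⁻¹.mulVec (fun j : Fin d => f (x₀ + fun a => S a j) - f x₀) k - gradf x₀ k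
        - (1 / 2) * (Sᵀ)⁻¹.mulVec
            (fun j : Fin d => (fun a => S a j) ⬝ᵥ (hess x₀).mulVec (fun a => S a j)) k := by
    rw [hRsplit, Matrix.mulVec_sub, Matrix.mulVec_sub, Matrix.mulVec_smul, hcancel]
    rfl
  rw [← hres]
  calc euclNorm ((Sᵀ)⁻¹.mulVec R) ≤ opNorm (Sᵀ)⁻¹ * euclNorm R := euclNorm_mulVec_le _ _
    _ ≤ opNorm (Sᵀ)⁻¹ * (L / 6 * Real.sqrt (∑ j, (∑ k, S k j ^ 2) ^ 3)) :=
      mul_le_mul_of_nonneg_left (euclNorm_le_sqrt_sum_pow (by positivity) R S hRbound)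
        (norm_nonneg _)
    _ = _ := by ring
end

section
/- Let H ∈ ℝ^{d×d} be symmetric, let R ∈ ℝ^{d×d} be orthogonal with RᵀHR = D diagonal, let σ > 0, and let S ∈ ℝ^{d×d} be invertible with columns s₁,…,s_d. Set S' = RᵀS with columns s'₁,…,s'_d. Then ‖S'‖₂ = ‖S‖₂ (ℓ²-operator norm), and AE_H(S) + NE(S) = AE_D(S') + NE(S'). Furthermore, for any diagonal matrix D and any invertible S, AE_D(S) = AE_{−D}(S). -/
open Matrix

/-- The approximation error `AE_H(S) = (1/4)‖S⁻ᵀ [s₁ᵀHs₁, …, s_dᵀHs_d]ᵀ‖₂²`,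
where `sᵢ` are the columns of `S`. -/
noncomputable def approxErr {n : Type*} [Fintype n] [DecidableEq n]
    (H S : Matrix n n ℝ) : ℝ :=
  (1 / 4) * ∑ i, ((Sᵀ)⁻¹.mulVec (fun j => (fun k => S k j) ⬝ᵥ H.mulVec (fun k => S k j)) i) ^ 2

/-- The noise error `NE(S) = σ²‖S⁻¹‖_F² + σ²‖S⁻ᵀ𝟙‖₂²`. -/
noncomputable def noiseErr {n : Type*} [Fintype n] [DecidableEq n]
    (σ : ℝ) (S : Matrix n n ℝ) : ℝ :=
  σ ^ 2 * ∑ i, ∑ j, (S⁻¹ i j) ^ 2 + σ ^ 2 * ∑ i, ((Sᵀ)⁻¹.mulVec (fun _ => 1) i) ^ 2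

theorem col_dotProduct_mulVec_col {n : Type*} [Fintype n] (H S : Matrix n n ℝ) (j : n) :
    (fun k => S k j) ⬝ᵥ H *ᵥ (fun k => S k j) = (Sᵀ * H * S) j j := by
  rw [Matrix.mul_assoc]
  rfl

section Orthogonal

variable {n : Type*} [Fintype n] [DecidableEq n]

/-- An orthogonal matrix preserves the sum of squares of the coordinates. -/
theorem sum_sq_mulVec_of_orthogonal {Q : Matrix n n ℝ} (hQ : Qᵀ * Q = 1) (v : n → ℝ) :
    ∑ i, (Q *ᵥ v) i ^ 2 = ∑ i, v i ^ 2 := by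
  have h : (Q *ᵥ v) ⬝ᵥ (Q *ᵥ v) = v ⬝ᵥ v := by
    rw [dotProduct_mulVec, vecMul_mulVec, ← mulVec_transpose]
    simp [hQ]
  simpa only [dotProduct, ← sq] using h

theorem inv_transpose_of_orthogonal {R : Matrix n n ℝ} (hR : Rᵀ * R = 1) (S : Matrix n n ℝ) :
    ((Rᵀ * S)ᵀ)⁻¹ = Rᵀ * (Sᵀ)⁻¹ := by
  rw [transpose_mul, transpose_transpose, Matrix.mul_inv_rev, inv_eq_left_inv hR]

theorem approxErr_rotate {R : Matrix n n ℝ} (hR : Rᵀ * R = 1) (H S : Matrix n n ℝ) :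
    approxErr (Rᵀ * H * R) (Rᵀ * S) = approxErr H S := by
  have hR' : R * Rᵀ = 1 := mul_eq_one_comm.mp hR
  have hconj : (Rᵀ * S)ᵀ * (Rᵀ * H * R) * (Rᵀ * S) = Sᵀ * H * S := by
    calc (Rᵀ * S)ᵀ * (Rᵀ * H * R) * (Rᵀ * S)
        = Sᵀ * (R * Rᵀ) * H * (R * Rᵀ) * S := by
          simp only [transpose_mul, transpose_transpose, Matrix.mul_assoc]
      _ = Sᵀ * H * S := by simp only [hR', Matrix.mul_one]
  simp only [approxErr, col_dotProduct_mulVec_col, hconj, inv_transpose_of_orthogonal hR]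
  simp only [← mulVec_mulVec (M := Rᵀ)]
  rw [sum_sq_mulVec_of_orthogonal (by rwa [transpose_transpose])]

theorem noiseErr_rotate {R : Matrix n n ℝ} (hR : Rᵀ * R = 1) (σ : ℝ) (S : Matrix n n ℝ) :
    noiseErr σ (Rᵀ * S) = noiseErr σ S := by
  have hR' : Rᵀᵀ * Rᵀ = 1 := by
    rw [transpose_transpose]
    exact mul_eq_one_comm.mp hR
  have hrow (i : n) : ∑ j, ((Rᵀ * S)⁻¹ i j) ^ 2 = ∑ j, (S⁻¹ i j) ^ 2 := by
    rw [← sum_sq_mulVec_of_orthogonal hR' (S⁻¹ i), Matrix.mul_inv_rev, inv_eq_right_inv hR,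
      mulVec_transpose]
    rfl
  simp only [noiseErr, hrow, inv_transpose_of_orthogonal hR, ← mulVec_mulVec]
  rw [sum_sq_mulVec_of_orthogonal hR']

theorem approxErr_neg (H S : Matrix n n ℝ) : approxErr (-H) S = approxErr H S := by
  have h : (fun j => (Sᵀ * -H * S) j j) = -fun j => (Sᵀ * H * S) j j := by
    ext j
    simp
  simp only [approxErr, col_dotProduct_mulVec_col, h, mulVec_neg, Pi.neg_apply, neg_sq]

end Orthogonal

theorem opNorm_rotate {d : ℕ} {R : Matrix (Fin d) (Fin d) ℝ} (hR : Rᵀ * R = 1)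
    (S : Matrix (Fin d) (Fin d) ℝ) : opNorm (Rᵀ * S) = opNorm S := by
  have hU : Rᵀ ∈ unitary (Matrix (Fin d) (Fin d) ℝ) := by
    rw [Unitary.mem_iff, star_eq_conjTranspose, conjTranspose_eq_transpose_of_trivial,
      transpose_transpose]
    exact ⟨mul_eq_one_comm.mp hR, hR⟩
  rw [opNorm, map_mul]
  exact CStarRing.norm_mem_unitary_mul _
    (Unitary.map_mem (Matrix.toEuclideanCLM (n := Fin d) (𝕜 := ℝ)) hU)

/-- Rotation invariance of the objective: with `S' = RᵀS` one has
`‖S'‖₂ = ‖S‖₂` and `AE_H(S) + NE(S) = AE_D(S') + NE(S')`; moreover `AE_D(S) = AE_{−D}(S)`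
for diagonal `D`. -/
theorem objective_rotation_invariance
    (d : ℕ) (σ : ℝ) (hσ : 0 < σ)
    (H R D S : Matrix (Fin d) (Fin d) ℝ)
    (hH : H.IsSymm) (hR : Rᵀ * R = 1)
    (hD : Rᵀ * H * R = D) (hDdiag : D.IsDiag)
    (hS : IsUnit S.det) :
    opNorm (Rᵀ * S) = opNorm S ∧
    approxErr H S + noiseErr σ S = approxErr D (Rᵀ * S) + noiseErr σ (Rᵀ * S) ∧
    ∀ (D' S' : Matrix (Fin d) (Fin d) ℝ), D'.IsDiag → IsUnit S'.det →
      approxErr D' S' = approxErr (-D') S' := by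
  subst hD
  exact ⟨opNorm_rotate hR S, by rw [approxErr_rotate hR, noiseErr_rotate hR],
    fun D' S' _ _ => (approxErr_neg D' S').symm⟩
end

section
/- Let D ∈ ℝ^{d×d} be diagonal, let σ, h > 0, let U, V ∈ ℝ^{d×d} be orthogonal matrices, and let Σ ∈ ℝ^{d×d} be diagonal with 0 < Σᵢᵢ ≤ h for all i. Then l̲(U,Σ) ≤ AE_D(U Σ Vᵀ) + NE(U Σ Vᵀ). -/
open Matrix

/-- The lower-bound objective
`l̲(U,Σ) = a(U,Σ)²/(4d·Σ_max²) + σ²Σᵢ 1/Σᵢᵢ² + σ²d/Σ_max²` with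
`a(U,Σ) = tr(Σ UᵀDU Σ)`. -/
noncomputable def lbar {d : ℕ} (Dv : Fin d → ℝ) (σ : ℝ)
    (U : Matrix (Fin d) (Fin d) ℝ) (Sv : Fin d → ℝ) : ℝ :=
  (Matrix.trace (Matrix.diagonal Sv * Uᵀ * Matrix.diagonal Dv * U * Matrix.diagonal Sv)) ^ 2
      / (4 * d * (⨆ i, Sv i) ^ 2)
    + σ ^ 2 * ∑ i, 1 / (Sv i) ^ 2 + σ ^ 2 * d / (⨆ i, Sv i) ^ 2

theorem sum_sq_mulVec_of_transpose_mul_self {n : Type*} [Fintype n] [DecidableEq n]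
    {Q : Matrix n n ℝ} (hQ : Qᵀ * Q = 1) (v : n → ℝ) :
    ∑ i, (Q *ᵥ v) i ^ 2 = ∑ i, v i ^ 2 := by
  have key : (Q *ᵥ v) ⬝ᵥ (Q *ᵥ v) = v ⬝ᵥ v := by
    rw [Matrix.dotProduct_mulVec, ← Matrix.mulVec_transpose, Matrix.mulVec_mulVec, hQ,
      Matrix.one_mulVec]
  simpa only [dotProduct, ← pow_two] using key

theorem inv_mul_diagonal_mul_transpose {n : Type*} [Fintype n] [DecidableEq n]
    {U V : Matrix n n ℝ} (hU : Uᵀ * U = 1) (hV : Vᵀ * V = 1)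
    {s : n → ℝ} (hs : ∀ i, s i ≠ 0) :
    (U * diagonal s * Vᵀ)⁻¹ = V * diagonal (fun i => (s i)⁻¹) * Uᵀ := by
  apply Matrix.inv_eq_right_inv
  have hd : diagonal s * diagonal (fun i => (s i)⁻¹) = 1 := by
    rw [diagonal_mul_diagonal, ← diagonal_one]
    congr 1
    funext i
    exact mul_inv_cancel₀ (hs i)
  calc U * diagonal s * Vᵀ * (V * diagonal (fun i => (s i)⁻¹) * Uᵀ)
      = U * diagonal s * (Vᵀ * V) * diagonal (fun i => (s i)⁻¹) * Uᵀ := by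
        simp only [Matrix.mul_assoc]
    _ = U * (diagonal s * diagonal (fun i => (s i)⁻¹)) * Uᵀ := by
        rw [hV, Matrix.mul_one, Matrix.mul_assoc U]
    _ = 1 := by rw [hd, Matrix.mul_one, mul_eq_one_comm.mp hU]

theorem sum_sq_div_sq_le_sum_sq_inv_transpose_mulVec {n : Type*} [Fintype n] [DecidableEq n]
    {U V : Matrix n n ℝ} (hU : Uᵀ * U = 1) (hV : Vᵀ * V = 1)
    {s : n → ℝ} {M : ℝ} (hs : ∀ i, 0 < s i) (hM : ∀ i, s i ≤ M) (w : n → ℝ) :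
    (∑ i, w i ^ 2) / M ^ 2 ≤ ∑ i, (((U * diagonal s * Vᵀ)ᵀ)⁻¹ *ᵥ w) i ^ 2 := by
  have hVt : Vᵀᵀ * Vᵀ = 1 := by rw [transpose_transpose, mul_eq_one_comm.mp hV]
  rw [← transpose_nonsing_inv,
    inv_mul_diagonal_mul_transpose hU hV fun i => (hs i).ne', transpose_mul, transpose_mul,
    transpose_transpose, diagonal_transpose, ← Matrix.mulVec_mulVec,
    sum_sq_mulVec_of_transpose_mul_self hU, ← Matrix.mulVec_mulVec,
    ← sum_sq_mulVec_of_transpose_mul_self hVt w, Finset.sum_div]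
  refine Finset.sum_le_sum fun i _ => ?_
  rw [mulVec_diagonal, mul_pow, inv_pow, mul_comm, ← div_eq_mul_inv]
  have := hs i
  have := hM i
  gcongr

theorem sum_sq_eq_trace_transpose_mul_self {n : Type*} [Fintype n] (A : Matrix n n ℝ) :
    ∑ i, ∑ j, A i j ^ 2 = trace (Aᵀ * A) := by
  rw [Finset.sum_comm]
  simp only [trace, diag_apply, Matrix.mul_apply, transpose_apply, pow_two]

theorem sum_sq_inv_mul_diagonal_mul_transpose {n : Type*} [Fintype n] [DecidableEq n]
    {U V : Matrix n n ℝ} (hU : Uᵀ * U = 1) (hV : Vᵀ * V = 1)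
    {s : n → ℝ} (hs : ∀ i, s i ≠ 0) :
    ∑ i, ∑ j, ((U * diagonal s * Vᵀ)⁻¹ i j) ^ 2 = ∑ i, 1 / s i ^ 2 := by
  rw [sum_sq_eq_trace_transpose_mul_self, inv_mul_diagonal_mul_transpose hU hV hs]
  set E := diagonal (fun i => (s i)⁻¹) with hE
  have hEt : Eᵀ = E := diagonal_transpose _
  calc trace ((V * E * Uᵀ)ᵀ * (V * E * Uᵀ))
      = trace (U * (E * (Vᵀ * V) * E * Uᵀ)) := by
        simp only [transpose_mul, transpose_transpose, hEt, Matrix.mul_assoc]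
    _ = trace (E * E) := by
        rw [trace_mul_comm, Matrix.mul_assoc, hU, hV, Matrix.mul_one, Matrix.mul_one]
    _ = ∑ i, 1 / s i ^ 2 := by
        rw [hE, diagonal_mul_diagonal, trace_diagonal]
        refine Finset.sum_congr rfl fun i _ => ?_
        rw [one_div, ← inv_pow, pow_two]

theorem sum_col_dotProduct_mulVec_col {n : Type*} [Fintype n] (H S : Matrix n n ℝ) :
    ∑ j, (fun k => S k j) ⬝ᵥ H *ᵥ (fun k => S k j) = trace (Sᵀ * (H * S)) := by
  simp only [trace, diag_apply, Matrix.mul_apply, dotProduct, mulVec, transpose_apply]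

theorem trace_transpose_mul_mul_of_svd {n : Type*} [Fintype n] [DecidableEq n]
    (H U : Matrix n n ℝ) {V : Matrix n n ℝ} (hV : Vᵀ * V = 1) (s : n → ℝ) :
    trace ((U * diagonal s * Vᵀ)ᵀ * (H * (U * diagonal s * Vᵀ))) =
      trace (diagonal s * Uᵀ * H * U * diagonal s) := by
  calc trace ((U * diagonal s * Vᵀ)ᵀ * (H * (U * diagonal s * Vᵀ)))
      = trace (V * (diagonal s * Uᵀ * H * U * diagonal s * Vᵀ)) := by
        simp only [transpose_mul, transpose_transpose, diagonal_transpose, Matrix.mul_assoc]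
    _ = trace (diagonal s * Uᵀ * H * U * diagonal s) := by
        rw [trace_mul_comm, Matrix.mul_assoc, hV, Matrix.mul_one]

/-- The lower-bound objective bounds the true objective:
`l̲(U,Σ) ≤ AE_D(UΣVᵀ) + NE(UΣVᵀ)`. -/
theorem lower_bound_objective_le
    (d : ℕ) (Dv : Fin d → ℝ) (σ h : ℝ) (hσ : 0 < σ) (hh : 0 < h)
    (U V : Matrix (Fin d) (Fin d) ℝ) (hU : Uᵀ * U = 1) (hV : Vᵀ * V = 1)
    (Sv : Fin d → ℝ) (hSv : ∀ i, 0 < Sv i ∧ Sv i ≤ h) :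
    lbar Dv σ U Sv ≤
      approxErr (Matrix.diagonal Dv) (U * Matrix.diagonal Sv * Vᵀ)
        + noiseErr σ (U * Matrix.diagonal Sv * Vᵀ) := by
  have hpos : ∀ i, 0 < Sv i := fun i => (hSv i).1
  have hM : ∀ i, Sv i ≤ ⨆ i, Sv i := fun i => le_ciSup (Set.finite_range Sv).bddAbove i
  unfold lbar approxErr noiseErr
  rw [sum_sq_inv_mul_diagonal_mul_transpose hU hV fun i => (hpos i).ne',
    ← trace_transpose_mul_mul_of_svd _ U hV, ← sum_col_dotProduct_mulVec_col]
  set S := U * diagonal Sv * Vᵀ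
  set M := ⨆ i, Sv i
  set w : Fin d → ℝ := fun j => (fun k => S k j) ⬝ᵥ diagonal Dv *ᵥ (fun k => S k j)
  have hnoise := sum_sq_div_sq_le_sum_sq_inv_transpose_mulVec hU hV hpos hM fun _ => 1
  have happrox := sum_sq_div_sq_le_sum_sq_inv_transpose_mulVec hU hV hpos hM w
  have hcauchy : (∑ j, w j) ^ 2 / d ≤ ∑ j, w j ^ 2 := by
    refine div_le_of_le_mul₀ (Nat.cast_nonneg d) (by positivity) ?_
    simpa [mul_comm] using sq_sum_le_card_mul_sum_sq (s := Finset.univ) (f := w)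
  have hfirst : (∑ j, w j) ^ 2 / (4 * d * M ^ 2) ≤
      1 / 4 * ∑ i, ((Sᵀ)⁻¹ *ᵥ w) i ^ 2 := by
    calc (∑ j, w j) ^ 2 / (4 * d * M ^ 2) = 1 / 4 * ((∑ j, w j) ^ 2 / d / M ^ 2) := by
          rw [mul_assoc, ← div_div, ← div_div]
          ring
      _ ≤ 1 / 4 * ((∑ j, w j ^ 2) / M ^ 2) := by gcongr
      _ ≤ _ := by gcongr
  have hlast : σ ^ 2 * d / M ^ 2 ≤ σ ^ 2 * ∑ i, ((Sᵀ)⁻¹ *ᵥ fun _ => 1) i ^ 2 := by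
    rw [mul_div_assoc]
    refine mul_le_mul_of_nonneg_left ?_ (sq_nonneg σ)
    simpa only [one_pow, Finset.sum_const, Finset.card_univ, Fintype.card_fin, nsmul_eq_mul,
      mul_one] using hnoise
  linarith
end

section
/- Let D ∈ ℝ^{d×d} be diagonal with increasing diagonal entries D₁ ≤ … ≤ D_d and Σᵢ Dᵢ ≥ 0, and let σ, h > 0. Then the infimum of l̲(U,Σ) over all orthogonal U ∈ ℝ^{d×d} and all diagonal Σ with 0 < Σᵢᵢ ≤ h equals the infimum of l̲(I,Σ) over all diagonal Σ with 0 < Σᵢᵢ ≤ h; in particular the identity matrix U = I together with a minimizer of Σ ↦ l̲(I,Σ) is a global minimizer of l̲. -/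
open Matrix

/-- The trace `a(U,Σ)` as a bilinear expression in the squared entries of `U`. -/
lemma trace_conj_diagonal {n : Type*} [Fintype n] [DecidableEq n]
    (D S : n → ℝ) (U : Matrix n n ℝ) :
    trace (diagonal S * Uᵀ * diagonal D * U * diagonal S)
      = ∑ i, ∑ j, S i ^ 2 * U j i ^ 2 * D j := by
  simp only [trace, diag_apply, mul_diagonal]
  refine Finset.sum_congr rfl fun i _ => ?_
  simp only [Matrix.mul_apply (N := U), mul_diagonal, diagonal_mul, transpose_apply,
    Finset.sum_mul]
  exact Finset.sum_congr rfl fun j _ => by ring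

lemma trace_conj_diagonal_one {n : Type*} [Fintype n] [DecidableEq n] (D S : n → ℝ) :
    trace (diagonal S * (1 : Matrix n n ℝ)ᵀ * diagonal D * 1 * diagonal S)
      = ∑ i, S i ^ 2 * D i := by
  rw [trace_conj_diagonal]
  refine Finset.sum_congr rfl fun i _ => ?_
  rw [Finset.sum_eq_single i] <;> simp +contextual [one_apply]

lemma sq_entries_mem_doublyStochastic {n : Type*} [Fintype n] [DecidableEq n]
    {U : Matrix n n ℝ} (hU : Uᵀ * U = 1) :
    (of fun i j => U i j ^ 2) ∈ doublyStochastic ℝ n := by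
  have hU' : U * Uᵀ = 1 := mul_eq_one_comm.mp hU
  rw [mem_doublyStochastic_iff_sum]
  refine ⟨fun i j => sq_nonneg _, fun i => ?_, fun j => ?_⟩
  · simpa [Matrix.mul_apply, sq] using congrFun (congrFun hU' i) i
  · simpa [Matrix.mul_apply, sq] using congrFun (congrFun hU j) j

/-- Some permutation of the weights does at least as well as a given orthogonal matrix. -/
lemma exists_perm_sum_le_trace {n : Type*} [Fintype n] [DecidableEq n]
    (D S : n → ℝ) {U : Matrix n n ℝ} (hU : Uᵀ * U = 1) :
    ∃ π : Equiv.Perm n, ∑ i, S (π i) ^ 2 * D i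
      ≤ trace (diagonal S * Uᵀ * diagonal D * U * diagonal S) := by
  let f : Matrix n n ℝ →ₗ[ℝ] ℝ :=
    { toFun := fun P => ∑ i, ∑ j, S i ^ 2 * P j i * D j
      map_add' := fun P Q => by simp [mul_add, add_mul, Finset.sum_add_distrib]
      map_smul' := fun c P => by
        simp only [Matrix.smul_apply, smul_eq_mul, RingHom.id_apply, Finset.mul_sum]
        exact Finset.sum_congr rfl fun i _ => Finset.sum_congr rfl fun j _ => by ring }
  have hmem := sq_entries_mem_doublyStochastic hU
  rw [← SetLike.mem_coe, doublyStochastic_eq_convexHull_permMatrix] at hmem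
  obtain ⟨_, ⟨π, rfl⟩, hle⟩ :=
    (f.concaveOn (convex_convexHull ℝ _)).exists_le_of_mem_convexHull
      (subset_convexHull ℝ _) hmem
  refine ⟨π, ?_⟩
  rw [trace_conj_diagonal]
  refine le_of_eq_of_le ?_ hle
  change _ = ∑ i, ∑ j, S i ^ 2 * π.permMatrix ℝ j i * D j
  rw [Finset.sum_comm]
  refine Finset.sum_congr rfl fun j _ => ?_
  simp [Equiv.Perm.permMatrix, PEquiv.toMatrix_apply, Equiv.toPEquiv_apply]

/-- If `∑ Tᵢ² Dᵢ < 0 ≤ ∑ Dᵢ`, the weights can be enlarged, without changing their maximum,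
so that the weighted sum vanishes. -/
lemma exists_weights_sum_eq_zero {d : ℕ} {D T : Fin d → ℝ} (hD : 0 ≤ ∑ i, D i)
    (hT : ∀ i, 0 < T i) (hneg : ∑ i, T i ^ 2 * D i < 0) :
    ∃ R : Fin d → ℝ, (∀ i, T i ≤ R i) ∧ (∀ i, R i ≤ ⨆ j, T j) ∧
      ∑ i, R i ^ 2 * D i = 0 := by
  set M := ⨆ j, T j
  set A := ∑ i, T i ^ 2 * D i
  set B := M ^ 2 * ∑ i, D i
  have hTM : ∀ i, T i ≤ M := le_ciSup (Set.finite_range T).bddAbove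
  have hB : 0 ≤ B := by positivity
  have hBA : 0 < B - A := by linarith
  set θ := -A / (B - A) with hθ
  have hθ0 : 0 ≤ θ := div_nonneg (by linarith) hBA.le
  have hθ1 : θ ≤ 1 := (div_le_one hBA).mpr (by linarith)
  have hsq : ∀ i, T i ^ 2 ≤ M ^ 2 := fun i => pow_le_pow_left₀ (hT i).le (hTM i) 2
  have hnn : ∀ i, T i ^ 2 ≤ (1 - θ) * T i ^ 2 + θ * M ^ 2 := fun i => by
    nlinarith [hsq i]
  have hM : ∀ i, (1 - θ) * T i ^ 2 + θ * M ^ 2 ≤ M ^ 2 := fun i => by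
    nlinarith [hsq i]
  refine ⟨fun i => √((1 - θ) * T i ^ 2 + θ * M ^ 2), fun i => Real.le_sqrt_of_sq_le (hnn i),
    fun i => Real.sqrt_le_iff.mpr ⟨(hT i).le.trans (hTM i), hM i⟩, ?_⟩
  calc ∑ i, √((1 - θ) * T i ^ 2 + θ * M ^ 2) ^ 2 * D i
      = ∑ i, ((1 - θ) * (T i ^ 2 * D i) + θ * (M ^ 2 * D i)) :=
        Finset.sum_congr rfl fun i _ => by
          rw [Real.sq_sqrt ((sq_nonneg _).trans (hnn i))]; ring
    _ = (1 - θ) * A + θ * B := by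
        rw [Finset.sum_add_distrib, ← Finset.mul_sum, ← Finset.mul_sum, ← Finset.mul_sum]
    _ = 0 := by rw [hθ]; field_simp; ring

lemma lbar_nonneg {d : ℕ} (D : Fin d → ℝ) (σ : ℝ) (U : Matrix (Fin d) (Fin d) ℝ)
    (S : Fin d → ℝ) : 0 ≤ lbar D σ U S := by
  unfold lbar
  positivity

lemma lbar_le_lbar {d : ℕ} {D S R : Fin d → ℝ} {σ : ℝ} {U V : Matrix (Fin d) (Fin d) ℝ}
    (hsup : ⨆ i, R i = ⨆ i, S i)
    (hinv : ∑ i, 1 / R i ^ 2 ≤ ∑ i, 1 / S i ^ 2)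
    (htr : trace (diagonal R * Vᵀ * diagonal D * V * diagonal R) ^ 2
      ≤ trace (diagonal S * Uᵀ * diagonal D * U * diagonal S) ^ 2) :
    lbar D σ V R ≤ lbar D σ U S := by
  unfold lbar
  rw [hsup]
  gcongr

/-- Every feasible pair `(U,Σ)` is dominated by a feasible pair `(I,Σ')`. -/
lemma exists_lbar_one_le {d : ℕ} {D : Fin d → ℝ} (hD : 0 ≤ ∑ i, D i) (σ : ℝ) {h : ℝ}
    {U : Matrix (Fin d) (Fin d) ℝ} (hU : Uᵀ * U = 1) {S : Fin d → ℝ}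
    (hS : ∀ i, 0 < S i ∧ S i ≤ h) :
    ∃ R : Fin d → ℝ, (∀ i, 0 < R i ∧ R i ≤ h) ∧ lbar D σ 1 R ≤ lbar D σ U S := by
  obtain ⟨π, hπ⟩ := exists_perm_sum_le_trace D S hU
  have hsup : ⨆ i, S (π i) = ⨆ i, S i := π.iSup_comp
  have hinv : ∑ i, 1 / S (π i) ^ 2 = ∑ i, 1 / S i ^ 2 :=
    Equiv.sum_comp π fun i => 1 / S i ^ 2
  rcases le_or_gt 0 (∑ i, S (π i) ^ 2 * D i) with hnn | hneg
  · refine ⟨fun i => S (π i), fun i => hS _, lbar_le_lbar hsup hinv.le ?_⟩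
    rw [trace_conj_diagonal_one]
    exact pow_le_pow_left₀ hnn hπ 2
  · obtain ⟨R, hle, hRM, hR0⟩ := exists_weights_sum_eq_zero hD (fun i => (hS (π i)).1) hneg
    have hpos : ∀ i, 0 < R i := fun i => (hS (π i)).1.trans_le (hle i)
    have hsupR : ⨆ i, R i = ⨆ i, S (π i) := by
      refine le_antisymm ?_ (ciSup_mono (Set.finite_range R).bddAbove hle)
      rcases isEmpty_or_nonempty (Fin d) with _ | _
      · simp
      · exact ciSup_le hRM
    refine ⟨R, fun i => ⟨hpos i, (hRM i).trans ?_⟩, lbar_le_lbar (hsupR.trans hsup) ?_ ?_⟩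
    · have : Nonempty (Fin d) := ⟨i⟩
      exact ciSup_le fun j => (hS (π j)).2
    · rw [← hinv]
      refine Finset.sum_le_sum fun i _ => one_div_le_one_div_of_le ?_ ?_
      · exact pow_pos (hS (π i)).1 2
      · exact pow_le_pow_left₀ (hS (π i)).1.le (hle i) 2
    · rw [trace_conj_diagonal_one, hR0, zero_pow two_ne_zero]
      exact sq_nonneg _

/-- The infimum of `l̲` over orthogonal `U` and feasible diagonal `Σ`
equals the infimum at `U = I`; in particular `U = I` together with a minimizer of
`Σ ↦ l̲(I,Σ)` is a global minimizer of `l̲`. -/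
theorem lower_bound_objective_identity_optimal
    (d : ℕ) (Dv : Fin d → ℝ) (hmono : Monotone Dv) (hsum : 0 ≤ ∑ i, Dv i)
    (σ h : ℝ) (hσ : 0 < σ) (hh : 0 < h) :
    sInf {x : ℝ | ∃ (U : Matrix (Fin d) (Fin d) ℝ) (Sv : Fin d → ℝ),
          Uᵀ * U = 1 ∧ (∀ i, 0 < Sv i ∧ Sv i ≤ h) ∧ x = lbar Dv σ U Sv}
      = sInf {x : ℝ | ∃ Sv : Fin d → ℝ, (∀ i, 0 < Sv i ∧ Sv i ≤ h) ∧ x = lbar Dv σ 1 Sv} ∧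
    ∀ Sv' : Fin d → ℝ, (∀ i, 0 < Sv' i ∧ Sv' i ≤ h) →
      (∀ Sv : Fin d → ℝ, (∀ i, 0 < Sv i ∧ Sv i ≤ h) → lbar Dv σ 1 Sv' ≤ lbar Dv σ 1 Sv) →
      ∀ (U : Matrix (Fin d) (Fin d) ℝ) (Sv : Fin d → ℝ), Uᵀ * U = 1 →
        (∀ i, 0 < Sv i ∧ Sv i ≤ h) → lbar Dv σ 1 Sv' ≤ lbar Dv σ U Sv := by
  refine ⟨le_antisymm ?_ ?_, fun Sv' _ hmin U Sv hU hSv => ?_⟩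
  · refine csInf_le_csInf ⟨0, ?_⟩ ⟨_, fun _ => h, fun _ => ⟨hh, le_rfl⟩, rfl⟩ ?_
    · rintro _ ⟨U, Sv, -, -, rfl⟩
      exact lbar_nonneg Dv σ U Sv
    · rintro _ ⟨Sv, hSv, rfl⟩
      exact ⟨1, Sv, by simp, hSv, rfl⟩
  · refine le_csInf ⟨_, 1, fun _ => h, by simp, fun _ => ⟨hh, le_rfl⟩, rfl⟩ ?_
    rintro _ ⟨U, Sv, hU, hSv, rfl⟩
    obtain ⟨R, hR, hle⟩ := exists_lbar_one_le hsum σ hU hSv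
    refine le_trans (csInf_le ⟨0, ?_⟩ ⟨R, hR, rfl⟩) hle
    rintro _ ⟨T, -, rfl⟩
    exact lbar_nonneg Dv σ 1 T
  · obtain ⟨R, hR, hle⟩ := exists_lbar_one_le hsum σ hU hSv
    exact (hmin R hR).trans hle
end

section
/- Let D ∈ ℝ^{d×d} be diagonal, σ, h > 0, and let Σ ∈ ℝ^{d×d} be diagonal with 0 < Σᵢᵢ ≤ h for all i. Let k be an index with Σ_kk = maxᵢ Σᵢᵢ, and let V ∈ ℝ^{d×d} be an orthogonal matrix with (Vᵢⱼ)² = 1/d for all i, j whose k-th column equals (1/√d)·𝟙. Then for S = Σ Vᵀ, AE_D(S) + NE(S) = l̲(I, Σ), i.e., the bound of the lower-bound objective is attained at this Hadamard-type choice of V. -/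
open Matrix

/-- The inverse of `ΣVᵀ` for an invertible diagonal `Σ` and an orthogonal `V`. -/
theorem inv_diagonal_mul_transpose {n : Type*} [Fintype n] [DecidableEq n]
    {s : n → ℝ} (hs : ∀ i, s i ≠ 0) {V : Matrix n n ℝ} (hV : Vᵀ * V = 1) :
    (diagonal s * Vᵀ)⁻¹ = V * diagonal (fun i => (s i)⁻¹) := by
  apply Matrix.inv_eq_right_inv
  rw [Matrix.mul_assoc, ← Matrix.mul_assoc Vᵀ, hV, Matrix.one_mul, diagonal_mul_diagonal]
  simp [hs]

/-- If one column of an orthogonal matrix is constant, the other columns sum to zero. -/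
theorem sum_col_of_const_col {n : Type*} [Fintype n] [DecidableEq n]
    {V : Matrix n n ℝ} (hV : Vᵀ * V = 1) {k : n} {c : ℝ} (hc : c ≠ 0)
    (hVk : ∀ i, V i k = c) (i : n) :
    ∑ j, V j i = if i = k then c⁻¹ else 0 := by
  have h := congrFun (congrFun hV i) k
  simp only [Matrix.mul_apply, transpose_apply, hVk, ← Finset.sum_mul, Matrix.one_apply] at h
  rw [eq_div_of_mul_eq hc h]
  split_ifs <;> simp

/-- At the Hadamard-type choice of `V`, the objective attains the lower
bound: `AE_D(ΣVᵀ) + NE(ΣVᵀ) = l̲(I,Σ)`. -/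
theorem lower_bound_attained_at_hadamard
    (d : ℕ) (Dv : Fin d → ℝ) (σ h : ℝ) (hσ : 0 < σ) (hh : 0 < h)
    (Sv : Fin d → ℝ) (hSv : ∀ i, 0 < Sv i ∧ Sv i ≤ h)
    (k : Fin d) (hk : Sv k = ⨆ i, Sv i)
    (V : Matrix (Fin d) (Fin d) ℝ) (hV : Vᵀ * V = 1)
    (hVsq : ∀ i j, (V i j) ^ 2 = 1 / d)
    (hVk : ∀ i, V i k = 1 / Real.sqrt d) :
    approxErr (Matrix.diagonal Dv) (Matrix.diagonal Sv * Vᵀ)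
        + noiseErr σ (Matrix.diagonal Sv * Vᵀ)
      = lbar Dv σ 1 Sv := by
  have hd : (0 : ℝ) < d := by exact_mod_cast k.pos
  have hs : ∀ i, Sv i ≠ 0 := fun i => (hSv i).1.ne'
  have hinv := inv_diagonal_mul_transpose hs hV
  have hcol := sum_col_of_const_col hV (by positivity) hVk
  have hmul : ∀ (c : ℝ), ∑ i, (((diagonal Sv * Vᵀ)ᵀ)⁻¹.mulVec (fun _ => c) i) ^ 2
      = c ^ 2 * d / Sv k ^ 2 := by
    intro c
    have hi : ∀ i, ((diagonal Sv * Vᵀ)ᵀ)⁻¹.mulVec (fun _ => c) i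
        = if i = k then c * √d / Sv k else 0 := by
      intro i
      rw [← transpose_nonsing_inv, hinv]
      simp only [mulVec, dotProduct, transpose_apply, mul_diagonal, ← Finset.sum_mul, hcol]
      split_ifs with h
      · subst h
        simp
        ring
      · simp
    simp_rw [hi]
    simp [div_pow, mul_pow, Real.sq_sqrt hd.le]
  have hquad : ∀ j, (fun l => (diagonal Sv * Vᵀ) l j) ⬝ᵥ
      (diagonal Dv).mulVec (fun l => (diagonal Sv * Vᵀ) l j)
      = (∑ l, Sv l * Dv l * Sv l) / d := by
    intro j
    simp only [dotProduct, mulVec_diagonal, diagonal_mul, transpose_apply, Finset.sum_div]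
    refine Finset.sum_congr rfl fun l _ => ?_
    linear_combination Sv l ^ 2 * Dv l * hVsq j l
  have hfrob : ∑ i, ∑ j, ((diagonal Sv * Vᵀ)⁻¹ i j) ^ 2 = ∑ i, 1 / Sv i ^ 2 := by
    rw [hinv, Finset.sum_comm]
    refine Finset.sum_congr rfl fun j _ => ?_
    simp [mul_diagonal, mul_pow, hVsq, hd.ne']
  have htr : trace (diagonal Sv * (1 : Matrix (Fin d) (Fin d) ℝ)ᵀ * diagonal Dv * 1 * diagonal Sv)
      = ∑ l, Sv l * Dv l * Sv l := by
    simp [diagonal_mul_diagonal, trace_diagonal]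
  have hk0 := hs k
  simp only [approxErr, noiseErr, lbar, hquad, hmul, hfrob, htr, ← hk]
  field_simp
  ring
end

section
/- Let D ∈ ℝ^{d×d} be diagonal with increasing diagonal entries and Σᵢ Dᵢ > 0, let σ, h > 0, let K = {i : Dᵢ ≤ 0}, and let A ⊆ {1,…,d} be an active set with K ⊆ A and |A| < d. Then a point λ ∈ ℝ₊^d with λᵢ = h² for i ∈ A is a stationary point of l_A (all partial derivatives ∂l_A/∂λᵢ vanish for i ∉ A) if and only if, setting a = Σ_{i∉A} Dᵢλᵢ + h²·Σ_{i∈A} Dᵢ, one has a > 0 and: λ₁ = h² if 1 ∈ A and λ₁ = (2d/(a·D₁))·(a²/(4d) + σ²(d+1)) otherwise; and for each 2 ≤ i ≤ d, λᵢ = h² if i ∈ A and λᵢ = σ·√(2d·λ₁/(a·Dᵢ)) otherwise. -/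
open Matrix

/-- The active-set function `l_A(λ)`: entries indexed by `A` are replaced by `h²`, and the
maximum is replaced by the first coordinate. -/
noncomputable def lA {d : ℕ} [NeZero d] (Dv : Fin d → ℝ) (σ h : ℝ)
    (A : Finset (Fin d)) (lam : Fin d → ℝ) : ℝ :=
  (∑ i, Dv i * (if i ∈ A then h ^ 2 else lam i)) ^ 2
      / (4 * d * (if (0 : Fin d) ∈ A then h ^ 2 else lam 0))
    + σ ^ 2 * ∑ i, 1 / (if i ∈ A then h ^ 2 else lam i)
    + σ ^ 2 * d / (if (0 : Fin d) ∈ A then h ^ 2 else lam 0)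

/-- The quantity `a = Σ_{i∉A} Dᵢλᵢ + h²·Σ_{i∈A} Dᵢ`. -/
noncomputable def aval {d : ℕ} (Dv : Fin d → ℝ) (h : ℝ)
    (A : Finset (Fin d)) (lam : Fin d → ℝ) : ℝ :=
  ∑ i ∈ Aᶜ, Dv i * lam i + h ^ 2 * ∑ i ∈ A, Dv i

/-- A sum of functions of the free coordinates has derivative the one of its `i`-th term along
the `i`-th free coordinate. -/
lemma hasDerivAt_sum_update {d : ℕ} (A : Finset (Fin d)) (lam : Fin d → ℝ) (c : ℝ) {i : Fin d}
    (hi : i ∉ A) (F : Fin d → ℝ → ℝ) (F' : ℝ) (hF : HasDerivAt (F i) F' (lam i)) :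
    HasDerivAt (fun t => ∑ j, F j (if j ∈ A then c else Function.update lam i t j)) F'
      (lam i) := by
  have key : ∀ j ∈ Finset.univ, HasDerivAt
      (fun t => F j (if j ∈ A then c else Function.update lam i t j))
      (if j = i then F' else 0) (lam i) := by
    intro j _
    by_cases hji : j = i
    · subst hji
      simpa [hi] using hF
    · simpa [hji] using hasDerivAt_const (lam i) (F j (if j ∈ A then c else lam j))
  simpa using HasDerivAt.fun_sum key

/-- `aval` is the full weighted sum, with active entries replaced by `h²`. -/
lemma aval_eq_sum {d : ℕ} (Dv : Fin d → ℝ) (h : ℝ) (A : Finset (Fin d)) (lam : Fin d → ℝ) :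
    aval Dv h A lam = ∑ i, Dv i * (if i ∈ A then h ^ 2 else lam i) := by
  rw [aval, ← Finset.sum_compl_add_sum A, Finset.mul_sum]
  congr 1
  · refine Finset.sum_congr rfl fun i hi => ?_
    rw [if_neg (Finset.mem_compl.mp hi)]
  · refine Finset.sum_congr rfl fun i hi => ?_
    rw [if_pos hi, mul_comm]

/-- The partial derivative of `lA` along a free coordinate other than the first. -/
lemma hasDerivAt_lA_of_ne_zero {d : ℕ} [NeZero d] (Dv : Fin d → ℝ) (σ h : ℝ)
    (A : Finset (Fin d)) (lam : Fin d → ℝ) (hA : ∀ i ∈ A, lam i = h ^ 2) {i : Fin d}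
    (hi : i ∉ A) (hi0 : i ≠ 0) (hlam : lam i ≠ 0) :
    HasDerivAt (fun t => lA Dv σ h A (Function.update lam i t))
      (2 * aval Dv h A lam * Dv i / (4 * d * lam 0) - σ ^ 2 / lam i ^ 2) (lam i) := by
  have h1 := hasDerivAt_sum_update A lam (h ^ 2) hi (fun j x => Dv j * x) (Dv i)
    (by simpa using (hasDerivAt_id (lam i)).const_mul (Dv i))
  have h2 := hasDerivAt_sum_update A lam (h ^ 2) hi (fun _ x => 1 / x) (-(lam i ^ 2)⁻¹)
    (by simpa using hasDerivAt_inv hlam)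
  have h0 : (if (0 : Fin d) ∈ A then h ^ 2 else lam 0) = lam 0 := by
    split_ifs with h0
    · exact (hA 0 h0).symm
    · rfl
  have h3 := (((h1.pow 2).div_const (4 * d * lam 0)).add (h2.const_mul (σ ^ 2))).add_const
    (σ ^ 2 * d / lam 0)
  refine (h3.congr_deriv ?_).congr_of_eventuallyEq (.of_forall fun t => ?_)
  rotate_left
  · simp [lA, Function.update_of_ne hi0.symm, h0]
  · simp only [Function.update_eq_self, ← aval_eq_sum]
    norm_num
    ring

/-- The partial derivative of `lA` along the first coordinate when it is free. -/
lemma hasDerivAt_lA_zero {d : ℕ} [NeZero d] (Dv : Fin d → ℝ) (σ h : ℝ)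
    (A : Finset (Fin d)) (lam : Fin d → ℝ) (h0 : (0 : Fin d) ∉ A) (hlam : lam 0 ≠ 0) :
    HasDerivAt (fun t => lA Dv σ h A (Function.update lam 0 t))
      ((2 * aval Dv h A lam * Dv 0 * lam 0 - aval Dv h A lam ^ 2) / (4 * d * lam 0 ^ 2)
        - σ ^ 2 * (d + 1) / lam 0 ^ 2) (lam 0) := by
  have hd : (d : ℝ) ≠ 0 := NeZero.ne _
  have h1 := hasDerivAt_sum_update A lam (h ^ 2) h0 (fun j x => Dv j * x) (Dv 0)
    (by simpa using (hasDerivAt_id (lam 0)).const_mul (Dv 0))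
  have h2 := hasDerivAt_sum_update A lam (h ^ 2) h0 (fun _ x => 1 / x) (-(lam 0 ^ 2)⁻¹)
    (by simpa using hasDerivAt_inv hlam)
  have h3 := (((h1.pow 2).div ((hasDerivAt_id (lam 0)).const_mul (4 * (d : ℝ)))
    (by simp [hd, hlam])).add (h2.const_mul (σ ^ 2))).add
    ((hasDerivAt_inv hlam).const_mul (σ ^ 2 * d))
  refine (h3.congr_deriv ?_).congr_of_eventuallyEq (.of_forall fun t => ?_)
  rotate_left
  · simp [lA, h0, div_eq_mul_inv]
  · simp only [Function.update_eq_self, ← aval_eq_sum, Pi.pow_apply, id]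
    field_simp
    norm_num
    ring

/-- The first-order condition along a free coordinate other than the first. -/
lemma stationary_iff_of_ne_zero {n a D m x σ : ℝ} (hn : 0 < n) (hD : 0 < D) (hm : 0 < m)
    (hx : 0 < x) (hσ : 0 < σ) :
    2 * a * D / (4 * n * m) - σ ^ 2 / x ^ 2 = 0 ↔
      0 < a ∧ x = σ * Real.sqrt (2 * n * m / (a * D)) := by
  have hcl : 2 * a * D / (4 * n * m) - σ ^ 2 / x ^ 2 = 0 ↔ a * D * x ^ 2 = σ ^ 2 * (2 * n * m) := by
    rw [sub_eq_zero, div_eq_div_iff (by positivity) (by positivity)]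
    constructor <;> intro h <;> linarith
  rw [hcl]
  have hsq (ha : 0 < a) : x = σ * Real.sqrt (2 * n * m / (a * D)) ↔
      a * D * x ^ 2 = σ ^ 2 * (2 * n * m) := by
    rw [← sq_eq_sq₀ hx.le (by positivity), mul_pow, Real.sq_sqrt (by positivity), ← mul_div_assoc,
      eq_div_iff (by positivity), mul_comm]
  refine ⟨fun h => ?_, fun h => (hsq h.1).1 h.2⟩
  have ha : 0 < a := by
    by_contra! ha
    have h1 : 0 < σ ^ 2 * (2 * n * m) := by positivity
    have h2 : a * (D * x ^ 2) ≤ 0 := mul_nonpos_of_nonpos_of_nonneg ha (by positivity)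
    linarith
  exact ⟨ha, (hsq ha).2 h⟩

/-- The first-order condition along the first coordinate. -/
lemma stationary_zero_iff {n a D x σ : ℝ} (hn : 0 < n) (hD : 0 < D) (hx : 0 < x) (hσ : 0 < σ) :
    (2 * a * D * x - a ^ 2) / (4 * n * x ^ 2) - σ ^ 2 * (n + 1) / x ^ 2 = 0 ↔
      0 < a ∧ x = 2 * n / (a * D) * (a ^ 2 / (4 * n) + σ ^ 2 * (n + 1)) := by
  have hcl : (2 * a * D * x - a ^ 2) / (4 * n * x ^ 2) - σ ^ 2 * (n + 1) / x ^ 2 = 0 ↔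
      2 * a * D * x = a ^ 2 + 4 * n * (σ ^ 2 * (n + 1)) := by
    have : (2 * a * D * x - a ^ 2) / (4 * n * x ^ 2) - σ ^ 2 * (n + 1) / x ^ 2 =
        (2 * a * D * x - (a ^ 2 + 4 * n * (σ ^ 2 * (n + 1)))) / (4 * n * x ^ 2) := by
      field_simp
      ring
    rw [this, div_eq_zero_iff, or_iff_left (by positivity), sub_eq_zero]
  rw [hcl]
  have hsol (ha : 0 < a) : x = 2 * n / (a * D) * (a ^ 2 / (4 * n) + σ ^ 2 * (n + 1)) ↔
      2 * a * D * x = a ^ 2 + 4 * n * (σ ^ 2 * (n + 1)) := by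
    have : 2 * n / (a * D) * (a ^ 2 / (4 * n) + σ ^ 2 * (n + 1)) =
        (a ^ 2 + 4 * n * (σ ^ 2 * (n + 1))) / (2 * a * D) := by
      field_simp
      ring
    rw [this, eq_div_iff (by positivity), mul_comm]
  refine ⟨fun h => ?_, fun h => (hsol h.1).1 h.2⟩
  have ha : 0 < a := by
    by_contra! ha
    have h1 : 0 < a ^ 2 + 4 * n * (σ ^ 2 * (n + 1)) := by positivity
    have h2 : a * (D * x) ≤ 0 := mul_nonpos_of_nonpos_of_nonneg ha (by positivity)
    linarith
  exact ⟨ha, (hsol ha).2 h⟩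

/-- Characterization of the stationary points of the active-set
function `l_A` by explicit first-order formulas. -/
theorem active_set_stationary_characterization
    (d : ℕ) [NeZero d] (Dv : Fin d → ℝ) (hmono : Monotone Dv)
    (hsum : 0 < ∑ i, Dv i) (σ h : ℝ) (hσ : 0 < σ) (hh : 0 < h)
    (A : Finset (Fin d)) (hKA : ∀ i, Dv i ≤ 0 → i ∈ A) (hAcard : A.card < d)
    (lam : Fin d → ℝ) (hpos : ∀ i, 0 < lam i) (hA : ∀ i ∈ A, lam i = h ^ 2) :
    (∀ i ∉ A,
        deriv (fun t => lA Dv σ h A (Function.update lam i t)) (lam i) = 0) ↔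
      (0 < aval Dv h A lam ∧
        lam 0 = (if (0 : Fin d) ∈ A then h ^ 2 else
          (2 * d / (aval Dv h A lam * Dv 0)) *
            ((aval Dv h A lam) ^ 2 / (4 * d) + σ ^ 2 * (d + 1))) ∧
        ∀ i : Fin d, i ≠ 0 →
          lam i = (if i ∈ A then h ^ 2 else
            σ * Real.sqrt (2 * d * lam 0 / (aval Dv h A lam * Dv i)))) := by
  have hd : (0 : ℝ) < d := Nat.cast_pos.2 (NeZero.pos d)
  have hDpos : ∀ i ∉ A, 0 < Dv i := fun i hi => by
    by_contra! hle
    exact hi (hKA i hle)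
  have hzero (h0 : (0 : Fin d) ∉ A) := stationary_zero_iff (a := aval Dv h A lam) hd (hDpos 0 h0)
    (hpos 0) hσ
  have hne (i : Fin d) (hi : i ∉ A) (hi0 : i ≠ 0) := stationary_iff_of_ne_zero
    (a := aval Dv h A lam) hd (hDpos i hi) (hpos 0) (hpos i) hσ
  constructor
  · intro hst
    have hst0 (h0 : (0 : Fin d) ∉ A) :=
      (hasDerivAt_lA_zero Dv σ h A lam h0 (hpos 0).ne').deriv.symm.trans (hst 0 h0)
    have hsti (i : Fin d) (hi : i ∉ A) (hi0 : i ≠ 0) :=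
      (hasDerivAt_lA_of_ne_zero Dv σ h A lam hA hi hi0 (hpos i).ne').deriv.symm.trans (hst i hi)
    refine ⟨?_, ?_, fun i hi0 => ?_⟩
    · obtain ⟨i, hi⟩ : ∃ i, i ∉ A := by
        by_contra! hall
        rw [Finset.eq_univ_iff_forall.2 hall, Finset.card_fin] at hAcard
        exact lt_irrefl _ hAcard
      by_cases hi0 : i = 0
      · subst hi0
        exact ((hzero hi).1 (hst0 hi)).1
      · exact ((hne i hi hi0).1 (hsti i hi hi0)).1
    · split_ifs with h0
      · exact hA 0 h0
      · exact ((hzero h0).1 (hst0 h0)).2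
    · split_ifs with hi
      · exact hA i hi
      · exact ((hne i hi hi0).1 (hsti i hi hi0)).2
  · rintro ⟨ha, hlam0, hlam⟩ i hi
    by_cases hi0 : i = 0
    · subst hi0
      rw [if_neg hi] at hlam0
      exact (hasDerivAt_lA_zero Dv σ h A lam hi (hpos 0).ne').deriv.trans <|
        (hzero hi).2 ⟨ha, hlam0⟩
    · have hlami := hlam i hi0
      rw [if_neg hi] at hlami
      exact (hasDerivAt_lA_of_ne_zero Dv σ h A lam hA hi hi0 (hpos i).ne').deriv.trans <|
        (hne i hi hi0).2 ⟨ha, hlami⟩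
end

section
/- Let D ∈ ℝ^{d×d} be diagonal with all diagonal entries positive, D₁ ≤ … ≤ D_d, and let σ > 0, d ≥ 1. Set C = Σ_{i=2}^d √(Dᵢ). Then there is exactly one a > 0 for which there exist λ₁, …, λ_d > 0 satisfying λ₁ = (2d/(a·D₁))·(a²/(4d) + σ²(d+1)), λᵢ = σ·√(2d·λ₁/(a·Dᵢ)) for 2 ≤ i ≤ d, and a = Σ_{i=1}^d Dᵢλᵢ; and this a is given by a = √2·( (dσ²/D₁)·( C·√(8D₁(d+1) + C²) + 2D₁(d+1) + C² ) )^{1/2}. -/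
open Matrix

/-- The first-order stationarity system for the empty active set: `a` is admissible iff
`a > 0` and there exist positive `λᵢ` with
`λ₁ = (2d/(aD₁))(a²/(4d) + σ²(d+1))`, `λᵢ = σ√(2dλ₁/(aDᵢ))` for `i ≥ 2`, and
`a = Σᵢ Dᵢλᵢ`. -/
def StatSystem {d : ℕ} [NeZero d] (Dv : Fin d → ℝ) (σ : ℝ) (a : ℝ) : Prop :=
  0 < a ∧ ∃ lam : Fin d → ℝ, (∀ i, 0 < lam i) ∧
    lam 0 = (2 * d / (a * Dv 0)) * (a ^ 2 / (4 * d) + σ ^ 2 * (d + 1)) ∧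
    (∀ i : Fin d, i ≠ 0 → lam i = σ * Real.sqrt (2 * d * lam 0 / (a * Dv i))) ∧
    a = ∑ i, Dv i * lam i

/-- `C = Σ_{i=2}^d √(Dᵢ)`. -/
noncomputable def Cval {d : ℕ} [NeZero d] (Dv : Fin d → ℝ) : ℝ :=
  ∑ i ∈ ({0} : Finset (Fin d))ᶜ, Real.sqrt (Dv i)

lemma statSystem_iff_scalar {d : ℕ} [NeZero d] {Dv : Fin d → ℝ} (hpos : ∀ i, 0 < Dv i)
    {σ : ℝ} (hσ : 0 < σ) (a : ℝ) :
    StatSystem Dv σ a ↔ 0 < a ∧ ∃ L : ℝ, 0 < L ∧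
      L = (2 * d / (a * Dv 0)) * (a ^ 2 / (4 * d) + σ ^ 2 * (d + 1)) ∧
      a = Dv 0 * L + σ * √(2 * d * L / a) * Cval Dv := by
  have hd : (0 : ℝ) < d := by exact_mod_cast Nat.pos_of_ne_zero (NeZero.ne d)
  have hterm (L : ℝ) (i : Fin d) : Dv i * (σ * √(2 * d * L / (a * Dv i))) =
      σ * √(2 * d * L / a) * √(Dv i) := by
    have h := Real.mul_self_sqrt (hpos i).le
    have h' := Real.sqrt_pos.2 (hpos i)
    rw [← div_div, Real.sqrt_div' _ (hpos i).le]
    field_simp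
    linear_combination (-(√(2 * d * L / a))) * h
  have hsum (f : Fin d → ℝ) : ∑ i, f i = f 0 + ∑ i ∈ ({0} : Finset (Fin d))ᶜ, f i := by
    rw [← Finset.sum_add_sum_compl {0} f, Finset.sum_singleton]
  constructor
  · rintro ⟨ha, lam, hlam, h0, hi, hs⟩
    refine ⟨ha, lam 0, hlam 0, h0, ?_⟩
    rw [hsum] at hs
    rw [Cval, Finset.mul_sum]
    refine hs.trans (congrArg _ (Finset.sum_congr rfl fun i hi0 => ?_))
    rw [hi i (by simpa using hi0), hterm]
  · rintro ⟨ha, L, hL, h0, hs⟩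
    refine ⟨ha, fun i => if i = 0 then L else σ * √(2 * d * L / (a * Dv i)), fun i => ?_,
      by simpa using h0, fun i hi => by simp [hi], ?_⟩
    · have := hpos i
      dsimp only
      split_ifs <;> positivity
    · rw [hsum]
      rw [Cval, Finset.mul_sum] at hs
      simp only [if_true]
      refine hs.trans (congrArg _ (Finset.sum_congr rfl fun i hi0 => ?_))
      rw [if_neg (by simpa using hi0), hterm]

lemma scalar_stationarity_iff {p σ n C a : ℝ} (hp : 0 < p) (hσ : 0 < σ) (hn : 0 < n)
    (hC : 0 ≤ C) (ha : 0 < a) :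
    (∃ L : ℝ, 0 < L ∧ L = (2 * n / (a * p)) * (a ^ 2 / (4 * n) + σ ^ 2 * (n + 1)) ∧
      a = p * L + σ * √(2 * n * L / a) * C) ↔
    a ^ 2 = 2 * ((n * σ ^ 2 / p) *
      (C * √(8 * p * (n + 1) + C ^ 2) + 2 * p * (n + 1) + C ^ 2)) := by
  have hT : √(8 * p * (n + 1) + C ^ 2) ^ 2 = 8 * p * (n + 1) + C ^ 2 :=
    Real.sq_sqrt (by positivity)
  have hT0 : 0 < √(8 * p * (n + 1) + C ^ 2) := Real.sqrt_pos.2 (by positivity)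
  set T := √(8 * p * (n + 1) + C ^ 2)
  constructor
  · rintro ⟨L, hL, h0, hs⟩
    have hw : 0 < √(2 * n * L / a) := Real.sqrt_pos.2 (by positivity)
    have hw2 : √(2 * n * L / a) ^ 2 = 2 * n * L / a := Real.sq_sqrt (by positivity)
    set w := √(2 * n * L / a)
    have hL' : 2 * (p * L * a) = a ^ 2 + 4 * n * σ ^ 2 * (n + 1) := by
      rw [h0]; field_simp; norm_num
    have hw3 : w ^ 2 * a = 2 * n * L := by rw [hw2]; field_simp
    have h1 : a ^ 2 = 4 * n * σ ^ 2 * (n + 1) + 2 * σ * C * (w * a) := by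
      linear_combination 2 * a * hs + hL'
    have h2 : p * (w * a) ^ 2 = n * (a ^ 2 + 4 * n * σ ^ 2 * (n + 1)) := by
      linear_combination p * a * hw3 + n * hL'
    have hv : 0 < w * a := by positivity
    have h3 : (p * (w * a) - n * σ * C - n * σ * T) * (p * (w * a) - n * σ * C + n * σ * T) = 0 := by
      linear_combination p * h2 + p * n * h1 - n ^ 2 * σ ^ 2 * hT
    have hTC : C < T := by
      apply lt_of_pow_lt_pow_left₀ 2 hT0.le
      rw [hT]
      linarith [show 0 < 8 * p * (n + 1) by positivity]
    have h4 : p * (w * a) = n * σ * C + n * σ * T := by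
      have : 0 < n * σ * (T - C) := mul_pos (by positivity) (by linarith)
      rcases mul_eq_zero.1 h3 with h | h
      · linarith
      · nlinarith [mul_pos hp hv]
    field_simp
    linear_combination p * h1 + 2 * σ * C * h4
  · intro h
    have h1 : p * a ^ 2 = 2 * n * σ ^ 2 * (C * T + 2 * p * (n + 1) + C ^ 2) := by
      rw [h]; field_simp
    refine ⟨_, by positivity, rfl, ?_⟩
    have hw : √(2 * n * (2 * n / (a * p) * (a ^ 2 / (4 * n) + σ ^ 2 * (n + 1))) / a) =
        n * σ * (C + T) / (p * a) := by
      rw [Real.sqrt_eq_iff_mul_self_eq (by positivity) (by positivity)]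
      field_simp
      linear_combination 4 * h1 - 4 * n * σ ^ 2 * hT
    rw [hw]
    field_simp
    linear_combination 2 * h1

/-- For the empty active set the stationarity system has a unique
solution `a > 0`, given in closed form. -/
theorem empty_active_set_unique_a
    (d : ℕ) [NeZero d] (hd : 1 ≤ d) (Dv : Fin d → ℝ)
    (hpos : ∀ i, 0 < Dv i) (hmono : Monotone Dv) (σ : ℝ) (hσ : 0 < σ) :
    (∃! a : ℝ, StatSystem Dv σ a) ∧
    StatSystem Dv σ (Real.sqrt 2 * Real.sqrt ((d * σ ^ 2 / Dv 0) *
      (Cval Dv * Real.sqrt (8 * Dv 0 * (d + 1) + (Cval Dv) ^ 2)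
        + 2 * Dv 0 * (d + 1) + (Cval Dv) ^ 2))) := by
  have hn : (0 : ℝ) < d := by exact_mod_cast hd
  have hp := hpos 0
  have hC : 0 ≤ Cval Dv := Finset.sum_nonneg fun i _ => Real.sqrt_nonneg _
  set S := (d * σ ^ 2 / Dv 0) * (Cval Dv * √(8 * Dv 0 * (d + 1) + (Cval Dv) ^ 2)
    + 2 * Dv 0 * (d + 1) + (Cval Dv) ^ 2) with hS_def
  have hS : 0 < S := by positivity
  have hiff (a : ℝ) : StatSystem Dv σ a ↔ a = √2 * √S := by
    rw [← Real.sqrt_mul zero_le_two, statSystem_iff_scalar hpos hσ]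
    constructor
    · rintro ⟨ha, h⟩
      rw [scalar_stationarity_iff hp hσ hn hC ha, ← hS_def] at h
      rw [← h, Real.sqrt_sq ha.le]
    · rintro rfl
      have ha : 0 < √(2 * S) := Real.sqrt_pos.2 (by positivity)
      refine ⟨ha, (scalar_stationarity_iff hp hσ hn hC ha).2 ?_⟩
      rw [Real.sq_sqrt (by positivity)]
  exact ⟨⟨_, (hiff _).2 rfl, fun y hy => (hiff y).1 hy⟩, (hiff _).2 rfl⟩
end

section
/- Let ι be a finite index type, let n : ι → ℕ, let σ > 0, and for each i ∈ ι let D_i ∈ ℝ^{n(i)×n(i)} be diagonal and S_i ∈ ℝ^{n(i)×n(i)} be invertible. Let D and S be the corresponding block-diagonal matrices (with blocks D_i and S_i respectively), of total size d = Σᵢ n(i). Then S is invertible and AE_D(S) + NE(S) = Σ_{i∈ι} ( AE_{D_i}(S_i) + NE(S_i) ), where in each summand the all-ones vector and Frobenius norm are taken in dimension n(i). -/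
open Matrix

namespace Matrix

variable {ι : Type*} [Fintype ι] [DecidableEq ι] {m : ι → Type*} [∀ i, Fintype (m i)]

theorem blockDiagonal'_mulVec_apply {R : Type*} [NonUnitalNonAssocSemiring R]
    (M : ∀ i, Matrix (m i) (m i) R) (v : (Σ i, m i) → R) (i : ι) (a : m i) :
    (blockDiagonal' M *ᵥ v) ⟨i, a⟩ = (M i *ᵥ fun b => v ⟨i, b⟩) a := by
  simp only [mulVec, dotProduct, Fintype.sum_sigma]
  rw [Finset.sum_eq_single i]
  · simp only [blockDiagonal'_apply_eq]
  · intro k _ hk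
    simp [blockDiagonal'_apply_ne M _ _ hk.symm]
  · simp

theorem blockDiagonal'_col_dotProduct {R : Type*} [NonUnitalNonAssocSemiring R]
    (M : ∀ i, Matrix (m i) (m i) R) (v : (Σ i, m i) → R) (i : ι) (b : m i) :
    (fun k => blockDiagonal' M k ⟨i, b⟩) ⬝ᵥ v = (fun a => M i a b) ⬝ᵥ fun a => v ⟨i, a⟩ := by
  have h := blockDiagonal'_mulVec_apply (fun k => (M k)ᵀ) v i b
  rw [← blockDiagonal'_transpose] at h
  exact h

variable [∀ i, DecidableEq (m i)] {R : Type*} [CommRing R]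

theorem blockDiagonal'_mul_blockDiagonal'_inv (M : ∀ i, Matrix (m i) (m i) R)
    (hM : ∀ i, IsUnit (M i).det) :
    blockDiagonal' M * blockDiagonal' (fun i => (M i)⁻¹) = 1 := by
  rw [← blockDiagonal'_mul, ← blockDiagonal'_one]
  exact congrArg blockDiagonal' (funext fun i => mul_nonsing_inv _ (hM i))

theorem inv_blockDiagonal' (M : ∀ i, Matrix (m i) (m i) R) (hM : ∀ i, IsUnit (M i).det) :
    (blockDiagonal' M)⁻¹ = blockDiagonal' fun i => (M i)⁻¹ :=
  inv_eq_right_inv (blockDiagonal'_mul_blockDiagonal'_inv M hM)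

end Matrix

section BlockDiagonal

variable {ι : Type*} [Fintype ι] [DecidableEq ι] {m : ι → Type*} [∀ i, Fintype (m i)]

theorem sum_sq_blockDiagonal' (M : ∀ i, Matrix (m i) (m i) ℝ) :
    ∑ x, ∑ y, blockDiagonal' M x y ^ 2 = ∑ i, ∑ a, ∑ b, M i a b ^ 2 := by
  simp only [Fintype.sum_sigma]
  refine Finset.sum_congr rfl fun i _ => Finset.sum_congr rfl fun a _ => ?_
  rw [Finset.sum_eq_single i]
  · simp only [blockDiagonal'_apply_eq]
  · intro k _ hk
    simp [blockDiagonal'_apply_ne M _ _ hk.symm]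
  · simp

variable [∀ i, DecidableEq (m i)]

theorem inv_transpose_blockDiagonal' (S : ∀ i, Matrix (m i) (m i) ℝ)
    (hS : ∀ i, IsUnit (S i).det) :
    ((blockDiagonal' S)ᵀ)⁻¹ = blockDiagonal' fun i => ((S i)ᵀ)⁻¹ := by
  rw [blockDiagonal'_transpose, inv_blockDiagonal' _ fun i => by simpa using hS i]

theorem approxErr_blockDiagonal' (H S : ∀ i, Matrix (m i) (m i) ℝ)
    (hS : ∀ i, IsUnit (S i).det) :
    approxErr (blockDiagonal' H) (blockDiagonal' S) = ∑ i, approxErr (H i) (S i) := by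
  simp only [approxErr, inv_transpose_blockDiagonal' S hS, Fintype.sum_sigma,
    blockDiagonal'_mulVec_apply, blockDiagonal'_col_dotProduct, blockDiagonal'_apply_eq,
    Finset.mul_sum]

theorem noiseErr_blockDiagonal' (σ : ℝ) (S : ∀ i, Matrix (m i) (m i) ℝ)
    (hS : ∀ i, IsUnit (S i).det) :
    noiseErr σ (blockDiagonal' S) = ∑ i, noiseErr σ (S i) := by
  simp only [noiseErr, inv_transpose_blockDiagonal' S hS, inv_blockDiagonal' S hS,
    sum_sq_blockDiagonal']
  simp only [Fintype.sum_sigma, blockDiagonal'_mulVec_apply, Finset.sum_add_distrib,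
    ← Finset.mul_sum]

end BlockDiagonal

/-- The objective splits over block-diagonal structure: for block-diagonal
`D` (diagonal blocks) and block-diagonal invertible `S`, `S` is invertible and
`AE_D(S) + NE(S) = Σᵢ (AE_{Dᵢ}(Sᵢ) + NE(Sᵢ))`. -/
theorem objective_block_diagonal_split
    {ι : Type*} [Fintype ι] [DecidableEq ι] (n : ι → ℕ) (σ : ℝ) (hσ : 0 < σ)
    (Dm : ∀ i, Matrix (Fin (n i)) (Fin (n i)) ℝ) (hD : ∀ i, (Dm i).IsDiag)
    (Sm : ∀ i, Matrix (Fin (n i)) (Fin (n i)) ℝ) (hS : ∀ i, IsUnit (Sm i).det) :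
    IsUnit (Matrix.blockDiagonal' Sm).det ∧
    approxErr (Matrix.blockDiagonal' Dm) (Matrix.blockDiagonal' Sm)
        + noiseErr σ (Matrix.blockDiagonal' Sm)
      = ∑ i, (approxErr (Dm i) (Sm i) + noiseErr σ (Sm i)) := by
  refine ⟨isUnit_det_of_right_inverse (blockDiagonal'_mul_blockDiagonal'_inv Sm hS), ?_⟩
  rw [approxErr_blockDiagonal' Dm Sm hS, noiseErr_blockDiagonal' σ Sm hS,
    Finset.sum_add_distrib]
end

section
/- Let D ∈ ℝ^{d×d} be diagonal and σ, h > 0. (i) If Σᵢ Dᵢᵢ = 0, then for every orthogonal U ∈ ℝ^{d×d} and every diagonal Σ with 0 < Σᵢᵢ ≤ h for all i, one has l̲(U,Σ) ≥ 2σ²d/h², with equality when U = I and Σ = h·I; in particular (I, h·I) is a global minimizer of l̲. (ii) If Σᵢ Dᵢᵢ > 0, then every global minimizer (U', Σ') of l̲ over orthogonal U and feasible diagonal Σ satisfies a(U', Σ') = tr(Σ' (U')ᵀ D U' Σ') ≥ 0. -/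
open Matrix

/-- The trace defining the objective, as a sum over the diagonal of `Uᵀ D U`. -/
theorem trace_diagonal_conj {d : ℕ} (Dv : Fin d → ℝ) (U : Matrix (Fin d) (Fin d) ℝ)
    (Sv : Fin d → ℝ) :
    Matrix.trace (Matrix.diagonal Sv * Uᵀ * Matrix.diagonal Dv * U * Matrix.diagonal Sv) =
      ∑ i, Sv i ^ 2 * (Uᵀ * Matrix.diagonal Dv * U) i i := by
  have hassoc : Matrix.diagonal Sv * Uᵀ * Matrix.diagonal Dv * U * Matrix.diagonal Sv =
      Matrix.diagonal Sv * (Uᵀ * Matrix.diagonal Dv * U) * Matrix.diagonal Sv := by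
    simp only [Matrix.mul_assoc]
  rw [hassoc, Matrix.trace]
  refine Finset.sum_congr rfl fun i _ => ?_
  rw [Matrix.diag_apply, Matrix.mul_diagonal, Matrix.diagonal_mul]
  ring

theorem sum_diag_orthogonal_conj {d : ℕ} (Dv : Fin d → ℝ) {U : Matrix (Fin d) (Fin d) ℝ}
    (hU : Uᵀ * U = 1) : ∑ i, (Uᵀ * Matrix.diagonal Dv * U) i i = ∑ i, Dv i := by
  change Matrix.trace (Uᵀ * Matrix.diagonal Dv * U) = _
  rw [Matrix.mul_assoc, Matrix.trace_mul_comm, Matrix.mul_assoc, mul_eq_one_comm.mp hU,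
    Matrix.mul_one, Matrix.trace_diagonal]

theorem le_lbar {d : ℕ} (Dv : Fin d → ℝ) (σ h : ℝ) (U : Matrix (Fin d) (Fin d) ℝ)
    (Sv : Fin d → ℝ) (hS : ∀ i, 0 < Sv i ∧ Sv i ≤ h) :
    2 * σ ^ 2 * d / h ^ 2 ≤ lbar Dv σ U Sv := by
  rcases Nat.eq_zero_or_pos d with rfl | hd
  · simp [lbar]
  have : Nonempty (Fin d) := ⟨⟨0, hd⟩⟩
  obtain ⟨j, hj⟩ := exists_eq_ciSup_of_finite (f := Sv)
  unfold lbar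
  rw [← hj]
  have hinv : ∀ i, 1 / h ^ 2 ≤ 1 / Sv i ^ 2 := fun i =>
    one_div_le_one_div_of_le (pow_pos (hS i).1 2) (pow_le_pow_left₀ (hS i).1.le (hS i).2 2)
  have hsum : (d : ℝ) * (1 / h ^ 2) ≤ ∑ i, 1 / Sv i ^ 2 := by
    simpa using Finset.sum_le_sum fun i (_ : i ∈ Finset.univ) => hinv i
  have hfst : 0 ≤ (Matrix.trace (Matrix.diagonal Sv * Uᵀ * Matrix.diagonal Dv * U *
      Matrix.diagonal Sv)) ^ 2 / (4 * d * Sv j ^ 2) := by positivity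
  have hsnd := mul_le_mul_of_nonneg_left hsum (sq_nonneg σ)
  have hthd := mul_le_mul_of_nonneg_left (hinv j) (by positivity : 0 ≤ σ ^ 2 * (d : ℝ))
  rw [mul_one_div, mul_one_div] at hthd
  have hsplit : 2 * σ ^ 2 * d / h ^ 2 = σ ^ 2 * (d * (1 / h ^ 2)) + σ ^ 2 * d / h ^ 2 := by ring
  linarith

theorem lbar_one_const {d : ℕ} (Dv : Fin d → ℝ) (σ h : ℝ) (hD : ∑ i, Dv i = 0) :
    lbar Dv σ 1 (fun _ => h) = 2 * σ ^ 2 * d / h ^ 2 := by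
  rcases Nat.eq_zero_or_pos d with rfl | hd
  · simp [lbar]
  have : Nonempty (Fin d) := ⟨⟨0, hd⟩⟩
  have ha : Matrix.trace (Matrix.diagonal (fun _ : Fin d => h) * (1 : Matrix (Fin d) (Fin d) ℝ)ᵀ *
      Matrix.diagonal Dv * 1 * Matrix.diagonal (fun _ => h)) = 0 := by
    rw [trace_diagonal_conj, ← Finset.mul_sum, sum_diag_orthogonal_conj Dv (by simp), hD, mul_zero]
  rw [lbar, ha, ciSup_const]
  simp only [Finset.sum_const, Finset.card_univ, Fintype.card_fin, nsmul_eq_mul]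
  ring

/-- Raising the squares of the diagonal of `Σ` linearly towards `Σ_max²` until `a` vanishes
strictly decreases the objective. -/
theorem exists_lbar_lt {d : ℕ} (Dv : Fin d → ℝ) (σ h : ℝ) (hD : 0 < ∑ i, Dv i)
    {U : Matrix (Fin d) (Fin d) ℝ} (hU : Uᵀ * U = 1) (Sv : Fin d → ℝ)
    (hS : ∀ i, 0 < Sv i ∧ Sv i ≤ h)
    (ha : Matrix.trace (Matrix.diagonal Sv * Uᵀ * Matrix.diagonal Dv * U *
      Matrix.diagonal Sv) < 0) :
    ∃ Tv : Fin d → ℝ, (∀ i, 0 < Tv i ∧ Tv i ≤ h) ∧ lbar Dv σ U Tv < lbar Dv σ U Sv := by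
  rcases Nat.eq_zero_or_pos d with rfl | hd
  · simp at hD
  have : Nonempty (Fin d) := ⟨⟨0, hd⟩⟩
  obtain ⟨j, hj⟩ := exists_eq_ciSup_of_finite (f := Sv)
  have hle : ∀ i, Sv i ≤ Sv j := fun i => hj ▸ le_ciSup (Set.finite_range Sv).bddAbove i
  have hjpos : 0 < Sv j := (hS j).1
  set a := Matrix.trace (Matrix.diagonal Sv * Uᵀ * Matrix.diagonal Dv * U *
    Matrix.diagonal Sv) with ha_def
  set b := Sv j ^ 2 * ∑ i, Dv i with hb_def
  have hb : 0 < b := by positivity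
  have hba : 0 < b - a := by linarith
  set l := -a / (b - a) with hl_def
  have hl0 : 0 ≤ l := div_nonneg (by linarith) hba.le
  have hl1 : l ≤ 1 := (div_le_one hba).2 (by linarith)
  have hsq : ∀ i, Sv i ^ 2 ≤ Sv j ^ 2 := fun i => pow_le_pow_left₀ (hS i).1.le (hle i) 2
  set q : Fin d → ℝ := fun i => (1 - l) * Sv i ^ 2 + l * Sv j ^ 2 with hq_def
  have hq_ge : ∀ i, Sv i ^ 2 ≤ q i := fun i => by
    have := mul_le_mul_of_nonneg_left (hsq i) hl0
    simp only [hq_def]; linarith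
  have hq_le : ∀ i, q i ≤ Sv j ^ 2 := fun i => by
    have := mul_le_mul_of_nonneg_left (hsq i) (sub_nonneg.2 hl1)
    simp only [hq_def]; linarith
  have hq_pos : ∀ i, 0 < q i := fun i => (pow_pos (hS i).1 2).trans_le (hq_ge i)
  have hT : ∀ i, √(q i) ^ 2 = q i := fun i => Real.sq_sqrt (hq_pos i).le
  have hT_le : ∀ i, √(q i) ≤ Sv j := fun i => Real.sqrt_le_iff.2 ⟨hjpos.le, hq_le i⟩
  have hsup : ⨆ i, √(q i) = Sv j := by
    refine le_antisymm (ciSup_le hT_le) ?_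
    exact (Real.le_sqrt' hjpos |>.2 (hq_ge j)).trans
      (le_ciSup (f := fun i => √(q i)) (Set.finite_range _).bddAbove j)
  have hzero : Matrix.trace (Matrix.diagonal (fun i => √(q i)) * Uᵀ * Matrix.diagonal Dv * U *
      Matrix.diagonal (fun i => √(q i))) = 0 := by
    have hlin : ∑ i, q i * (Uᵀ * Matrix.diagonal Dv * U) i i = (1 - l) * a + l * b := by
      rw [ha_def, hb_def, trace_diagonal_conj, ← sum_diag_orthogonal_conj Dv hU]
      simp only [hq_def, Finset.mul_sum, ← Finset.sum_add_distrib]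
      exact Finset.sum_congr rfl fun i _ => by ring
    rw [trace_diagonal_conj]
    simp only [hT]
    rw [hlin, hl_def]
    field_simp
    ring
  refine ⟨fun i => √(q i), fun i => ⟨Real.sqrt_pos.2 (hq_pos i), (hT_le i).trans (hS j).2⟩, ?_⟩
  have hfst : 0 < a ^ 2 / (4 * d * Sv j ^ 2) := by
    have : a ≠ 0 := ha.ne
    positivity
  have hsum : ∑ i, 1 / √(q i) ^ 2 ≤ ∑ i, 1 / Sv i ^ 2 := Finset.sum_le_sum fun i _ => by
    rw [hT]
    exact one_div_le_one_div_of_le (pow_pos (hS i).1 2) (hq_ge i)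
  have hsnd := mul_le_mul_of_nonneg_left hsum (sq_nonneg σ)
  rw [lbar, lbar, hzero, hsup, ← hj, ← ha_def, zero_pow two_ne_zero, zero_div]
  linarith

/-- (i) If `Σᵢ Dᵢ = 0` then `l̲ ≥ 2σ²d/h²` with equality at `(I, hI)`,
so `(I, hI)` is a global minimizer. (ii) If `Σᵢ Dᵢ > 0` then every global minimizer
`(U', Σ')` of `l̲` satisfies `a(U', Σ') ≥ 0`. -/
theorem lbar_zero_trace_and_positive_trace
    (d : ℕ) (Dv : Fin d → ℝ) (σ h : ℝ) (hσ : 0 < σ) (hh : 0 < h) :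
    ((∑ i, Dv i) = 0 →
      (∀ U : Matrix (Fin d) (Fin d) ℝ, Uᵀ * U = 1 → ∀ Sv : Fin d → ℝ,
        (∀ i, 0 < Sv i ∧ Sv i ≤ h) → 2 * σ ^ 2 * d / h ^ 2 ≤ lbar Dv σ U Sv) ∧
      lbar Dv σ 1 (fun _ => h) = 2 * σ ^ 2 * d / h ^ 2 ∧
      (∀ U : Matrix (Fin d) (Fin d) ℝ, Uᵀ * U = 1 → ∀ Sv : Fin d → ℝ,
        (∀ i, 0 < Sv i ∧ Sv i ≤ h) → lbar Dv σ 1 (fun _ => h) ≤ lbar Dv σ U Sv)) ∧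
    (0 < ∑ i, Dv i →
      ∀ (U' : Matrix (Fin d) (Fin d) ℝ) (Sv' : Fin d → ℝ), U'ᵀ * U' = 1 →
        (∀ i, 0 < Sv' i ∧ Sv' i ≤ h) →
        (∀ (U : Matrix (Fin d) (Fin d) ℝ) (Sv : Fin d → ℝ), Uᵀ * U = 1 →
          (∀ i, 0 < Sv i ∧ Sv i ≤ h) → lbar Dv σ U' Sv' ≤ lbar Dv σ U Sv) →
        0 ≤ Matrix.trace
          (Matrix.diagonal Sv' * U'ᵀ * Matrix.diagonal Dv * U' * Matrix.diagonal Sv')) := by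
  refine ⟨fun hD => ⟨fun U _ Sv hS => le_lbar Dv σ h U Sv hS, lbar_one_const Dv σ h hD,
    fun U _ Sv hS => (lbar_one_const Dv σ h hD).trans_le (le_lbar Dv σ h U Sv hS)⟩,
    fun hD U Sv hU hS hmin => ?_⟩
  by_contra! ha
  obtain ⟨Tv, hT, hlt⟩ := exists_lbar_lt Dv σ h hD hU Sv hS ha
  exact (hmin U Tv hU hT).not_gt hlt
end
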